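/- Let 1 < q < ∞ and let ν be a radial weight with ν̂ > 0 on [0,1) belonging to the Bekollé–Bonami class B_q. Then ν ∈ D. -/

import Mathlib

open MeasureTheory Set
open scoped ENNReal ComplexConjugate

noncomputable section

/-- The open unit disc in `ℂ`. -/
def UD : Set ℂ := Metric.ball (0 : ℂ) 1

/-- Normalized area measure `dA = dx dy / π` on `ℂ`. -/
def dA : Measure ℂ := (ENNReal.ofReal Real.pi)⁻¹ • (MeasureTheory.volume : Measure ℂ)

/-- `ω̂(r) = ∫_r^1 ω(s) ds` for a (radial) weight `ω : ℂ → ℝ`. -/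
def what (ω : ℂ → ℝ) (r : ℝ) : ℝ := ∫ s in r..(1 : ℝ), ω (s : ℂ)

/-- A radial weight: nonnegative, radial, integrable over the unit disc. -/
def RadialWeight (ω : ℂ → ℝ) : Prop :=
  (∀ z, 0 ≤ ω z) ∧ (∀ z : ℂ, ω z = ω ((‖z‖ : ℝ) : ℂ)) ∧ IntegrableOn ω UD dA

/-- `ω̂ > 0` on `[0,1)`. -/
def WhatPos (ω : ℂ → ℝ) : Prop := ∀ r : ℝ, 0 ≤ r → r < 1 → 0 < what ω r

/-- The class `D̂`. -/
def Dhat (ω : ℂ → ℝ) : Prop :=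
  ∃ C > (1 : ℝ), ∀ r : ℝ, 0 ≤ r → r < 1 → what ω r ≤ C * what ω ((1 + r) / 2)

/-- The class `Ď`. -/
def Dcheck (ω : ℂ → ℝ) : Prop :=
  ∃ K > (1 : ℝ), ∃ C > (1 : ℝ), ∀ r : ℝ, 0 ≤ r → r < 1 →
    C * what ω (1 - (1 - r) / K) ≤ what ω r

/-- The class `D = D̂ ∩ Ď`. -/
def Dclass (ω : ℂ → ℝ) : Prop := Dhat ω ∧ Dcheck ω

/-- A `Ď`-exponent `α > 0` for `ω`: `ω̂(t) ≤ C ((1-t)/(1-r))^α ω̂(r)` for `0 ≤ r ≤ t < 1`. -/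
def DcheckExp (ω : ℂ → ℝ) (α : ℝ) : Prop :=
  ∃ C > (0 : ℝ), ∀ r t : ℝ, 0 ≤ r → r ≤ t → t < 1 →
    what ω t ≤ C * ((1 - t) / (1 - r)) ^ α * what ω r

/-- A `D̂`-exponent `β > 0` for `ω`: `ω̂(r) ≤ C ((1-r)/(1-t))^β ω̂(t)` for `0 ≤ r ≤ t < 1`. -/
def DhatExp (ω : ℂ → ℝ) (β : ℝ) : Prop :=
  ∃ C > (0 : ℝ), ∀ r t : ℝ, 0 ≤ r → r ≤ t → t < 1 →
    what ω r ≤ C * ((1 - r) / (1 - t)) ^ β * what ω t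

/-- Weighted `L^p` "norm" over the unit disc. -/
def wnorm (p : ℝ) (ω : ℂ → ℝ) (f : ℂ → ℂ) : ℝ :=
  (∫ z in UD, ‖f z‖ ^ p * ω z ∂dA) ^ (1 / p)

/-- Membership in the weighted Lebesgue space `L^p_ω`. -/
def MemLw (p : ℝ) (ω : ℂ → ℝ) (f : ℂ → ℂ) : Prop :=
  AEStronglyMeasurable f (dA.restrict UD) ∧
  IntegrableOn (fun z => ‖f z‖ ^ p * ω z) UD dA

/-- Membership in the weighted Bergman space `A^p_ω`. -/
def MemAp (p : ℝ) (ω : ℂ → ℝ) (f : ℂ → ℂ) : Prop :=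
  DifferentiableOn ℂ f UD ∧ IntegrableOn (fun z => ‖f z‖ ^ p * ω z) UD dA

/-- `H^∞`: bounded analytic functions on the unit disc. -/
def Hinfty (f : ℂ → ℂ) : Prop :=
  DifferentiableOn ℂ f UD ∧ ∃ M : ℝ, ∀ z ∈ UD, ‖f z‖ ≤ M

/-- Moments `ν_x = ∫_0^1 t^x ν(t) dt`. -/
def mom (ν : ℂ → ℝ) (x : ℝ) : ℝ := ∫ t in (0 : ℝ)..1, t ^ x * ν (t : ℂ)

/-- The Bergman reproducing kernel of `A²_ν`. -/
def Bker (ν : ℂ → ℝ) (z ζ : ℂ) : ℂ :=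
  ∑' n : ℕ, (ζ * conj z) ^ n / (((2 * mom ν (2 * (n : ℝ) + 1) : ℝ)) : ℂ)

/-- The Bergman projection `P_ν`. -/
def Pw (ν : ℂ → ℝ) (f : ℂ → ℂ) (z : ℂ) : ℂ :=
  ∫ ζ in UD, f ζ * conj (Bker ν z ζ) * ((ν ζ : ℝ) : ℂ) ∂dA

/-- The Hankel operator `H_f^ν(g) = f g − P_ν(f g)`. -/
def Hankel (ν : ℂ → ℝ) (f g : ℂ → ℂ) (z : ℂ) : ℂ :=
  f z * g z - Pw ν (fun ζ => f ζ * g ζ) z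

/-- The standard weighted Bergman projection `P_η`. -/
def Pstd (η : ℝ) (f : ℂ → ℂ) (z : ℂ) : ℂ :=
  (((η + 1 : ℝ)) : ℂ) *
    ∫ ζ in UD, f ζ * (((1 - ‖ζ‖ ^ 2) ^ η : ℝ) : ℂ) *
      (1 - z * conj ζ) ^ (((-(2 + η) : ℝ)) : ℂ) ∂dA

/-- The Bekollé–Bonami class `B_q` (for radial weights). -/
def Bq (q : ℝ) (ν : ℂ → ℝ) : Prop :=
  ∃ η > (-1 : ℝ), ∃ C > (0 : ℝ), ∀ f : ℂ → ℂ, MemLw q ν f →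
    wnorm q ν (Pstd η f) ≤ C * wnorm q ν f

/-- Pseudo-hyperbolic distance. -/
def pd (z ζ : ℂ) : ℝ := ‖(z - ζ) / (1 - conj z * ζ)‖

/-- Hyperbolic distance `β(z,ζ)`. -/
def hyp (z ζ : ℂ) : ℝ := (1 / 2) * Real.log ((1 + pd z ζ) / (1 - pd z ζ))

/-- The hyperbolic disc `Δ(z,r)`. -/
def hDisc (z : ℂ) (r : ℝ) : Set ℂ := {ζ ∈ UD | hyp z ζ < r}

/-- `ν(Δ(z,r))`. -/
def nuD (ν : ℂ → ℝ) (z : ℂ) (r : ℝ) : ℝ := ∫ ζ in hDisc z r, ν ζ ∂dA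

/-- The function `γ(z)`. -/
def gam (ω ν : ℂ → ℝ) (p q : ℝ) (z : ℂ) : ℝ :=
  (what ν ‖z‖) ^ (1 / q) * (1 - ‖z‖) ^ (1 / q) /
    ((what ω ‖z‖) ^ (1 / p) * (1 - ‖z‖) ^ (1 / p))

/-- The average `f̂_{r,ν}(z)`. -/
def havg (ν : ℂ → ℝ) (r : ℝ) (f : ℂ → ℂ) (z : ℂ) : ℂ :=
  (∫ ζ in hDisc z r, ν ζ • f ζ ∂dA) / ((nuD ν z r : ℝ) : ℂ)

/-- The mean oscillation `MO_{ν,q,r}(f)(z)`. -/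
def MO (ν : ℂ → ℝ) (q r : ℝ) (f : ℂ → ℂ) (z : ℂ) : ℝ :=
  ((∫ ζ in hDisc z r, ‖f ζ - havg ν r f z‖ ^ q * ν ζ ∂dA) / nuD ν z r) ^ (1 / q)

/-- Finiteness of the `BMO(Δ)_{ω,ν,p,q,r}` norm. -/
def BMOfin (ω ν : ℂ → ℝ) (p q r : ℝ) (f : ℂ → ℂ) : Prop :=
  ∃ M : ℝ, ∀ z ∈ UD, MO ν q r f z * gam ω ν p q z ≤ M

/-- Boundedness of the Hankel operator `H_f^ν : A^p_ω → L^q_ν` tested on `H^∞`. -/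
def HankelBdd (p q : ℝ) (ω ν : ℂ → ℝ) (f : ℂ → ℂ) : Prop :=
  ∃ C > (0 : ℝ), ∀ g : ℂ → ℂ, Hinfty g → wnorm q ν (Hankel ν f g) ≤ C * wnorm p ω g

/-- `ω̂` extended by the convention `ω̂(t) = ω̂(0)` for `t < 0`. -/
def whatE (ω : ℂ → ℝ) (t : ℝ) : ℝ := what ω (max t 0)

/-- The function `Γ_τ(z,ζ)`. -/
def Gam (ω ν : ℂ → ℝ) (p q τ : ℝ) (z ζ : ℂ) : ℝ :=
  ((‖1 - conj z * ζ‖ ^ 2 / max (1 - ‖z‖ ^ 2) (1 - ‖ζ‖ ^ 2)) ^ (1 / p - (τ + 1) / q) *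
      whatE ω (1 - 2 * ‖1 - conj z * ζ‖ ^ 2 / max (1 - ‖z‖ ^ 2) (1 - ‖ζ‖ ^ 2)) ^ (1 / p)) /
    (min (what ν ‖z‖ / (1 - ‖z‖) ^ τ) (what ν ‖ζ‖ / (1 - ‖ζ‖) ^ τ)) ^ (1 / q)

/-- The generalized Berezin transform `B_{ν,c,σ}(φ)(z)` of a real-valued `φ`. -/
def Ber (ν : ℂ → ℝ) (c σ : ℝ) (φ : ℂ → ℝ) (z : ℂ) : ℝ :=
  (1 - ‖z‖ ^ 2) ^ (c + 1) / what ν ‖z‖ *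
    ∫ ζ in UD, φ ζ * (1 - ‖ζ‖ ^ 2) ^ σ * ‖1 - z * conj ζ‖ ^ (-(2 + c + σ)) * ν ζ ∂dA

/-- The operator `T_{b,c}`. -/
def Tbc (b c : ℝ) (f : ℂ → ℂ) (z : ℂ) : ℂ :=
  ∫ ζ in UD, f ζ * (((1 - ‖ζ‖ ^ 2) ^ b : ℝ) : ℂ) * (1 - z * conj ζ) ^ (((-c : ℝ)) : ℂ) ∂dA

/-- The operator `S_{b,c}`. -/
def Sbc (b c : ℝ) (f : ℂ → ℂ) (z : ℂ) : ℂ :=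
  ∫ ζ in UD, f ζ * ((((1 - ‖ζ‖ ^ 2) ^ b * ‖1 - z * conj ζ‖ ^ (-c)) : ℝ) : ℂ) ∂dA

/-- The standard kernel `B^η_z(ζ) = (1 − conj(z) ζ)^{−(2+η)}`. -/
def Bstd (η : ℝ) (z ζ : ℂ) : ℂ := (1 - conj z * ζ) ^ (((-(2 + η) : ℝ)) : ℂ)

/-- The normalized kernel `b^η_{z,ω}`. -/
def bnrm (p : ℝ) (ω : ℂ → ℝ) (η : ℝ) (z ζ : ℂ) : ℂ :=
  Bstd η z ζ / ((wnorm p ω (Bstd η z) : ℝ) : ℂ)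

/-- The function `g^η_{z,ω} = P_ν(conj(f) b^η_{z,ω}) / b^η_{z,ω}`. -/
def gfn (ν : ℂ → ℝ) (p : ℝ) (ω : ℂ → ℝ) (η : ℝ) (f : ℂ → ℂ) (z ζ : ℂ) : ℂ :=
  Pw ν (fun u => conj (f u) * bnrm p ω η z u) ζ / bnrm p ω η z ζ

end

/-- The open polar rectangle `{z : a < |z| < b, |arg z| < δ}`. -/
def polarRect (a b δ : ℝ) : Set ℂ := {z | ‖z‖ ∈ Ioo a b ∧ z.arg ∈ Ioo (-δ) δ}

lemma measurableSet_polarRect (a b δ : ℝ) : MeasurableSet (polarRect a b δ) :=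
  (measurableSet_Ioo.preimage measurable_norm).inter
    (measurableSet_Ioo.preimage Complex.measurable_arg)

lemma polarRect_subset_UD {a b δ : ℝ} (hb : b ≤ 1) : polarRect a b δ ⊆ UD := by
  intro z hz
  simpa [UD] using hz.1.2.trans_le hb

lemma dA_UD_lt_top : dA UD < ⊤ := by
  rw [dA, Measure.smul_apply, smul_eq_mul]
  refine ENNReal.mul_lt_top ?_ measure_ball_lt_top
  rw [ENNReal.inv_lt_top]
  exact ENNReal.ofReal_pos.2 Real.pi_pos

lemma dA_polarRect_lt_top {a b δ : ℝ} (hb : b ≤ 1) : dA (polarRect a b δ) < ⊤ :=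
  (measure_mono (polarRect_subset_UD hb)).trans_lt dA_UD_lt_top

lemma setIntegral_polarRect (w : ℂ → ℝ) (hw : ∀ z : ℂ, w z = w ((‖z‖ : ℝ) : ℂ))
    {a b δ : ℝ} (ha : 0 ≤ a) (hδ : 0 ≤ δ) (hδπ : δ ≤ Real.pi) :
    ∫ z in polarRect a b δ, w z ∂dA = 2 * δ / Real.pi * ∫ s in Ioo a b, s * w (s : ℂ) := by
  have hsub : Ioo a b ×ˢ Ioo (-δ) δ ⊆ polarCoord.target := by
    rw [polarCoord_target]
    exact prod_mono (fun x hx => ha.trans_lt hx.1) (Ioo_subset_Ioo (by linarith) hδπ)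
  have key : ∫ z in polarRect a b δ, w z = (∫ s in Ioo a b, s * w (s : ℂ)) * (2 * δ) := by
    rw [← integral_indicator (measurableSet_polarRect a b δ),
      ← Complex.integral_comp_polarCoord_symm]
    have h1 : ∀ p ∈ polarCoord.target,
        p.1 • (polarRect a b δ).indicator w (Complex.polarCoord.symm p) =
          (Ioo a b ×ˢ Ioo (-δ) δ).indicator
            (fun p : ℝ × ℝ => (p.1 * w (p.1 : ℂ)) * (1 : ℝ)) p := by
      intro p hp
      rw [polarCoord_target] at hp
      have hp1 : 0 < p.1 := hp.1
      have hn : ‖Complex.polarCoord.symm p‖ = p.1 := by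
        rw [Complex.norm_polarCoord_symm, abs_of_pos hp1]
      have harg : (Complex.polarCoord.symm p).arg = p.2 := by
        rw [Complex.polarCoord_symm_apply]
        have := Complex.arg_mul_cos_add_sin_mul_I hp1 (Ioo_subset_Ioc_self hp.2)
        simpa using this
      by_cases h : p ∈ Ioo a b ×ˢ Ioo (-δ) δ
      · have h' : Complex.polarCoord.symm p ∈ polarRect a b δ := by
          rw [polarRect, mem_ofPred_eq, hn, harg]; exact h
        rw [indicator_of_mem h, indicator_of_mem h', hw, hn, smul_eq_mul, mul_one]
      · have h' : Complex.polarCoord.symm p ∉ polarRect a b δ := by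
          rw [polarRect, mem_ofPred_eq, hn, harg]; exact h
        rw [indicator_of_notMem h, indicator_of_notMem h', smul_zero]
    rw [setIntegral_congr_fun polarCoord.open_target.measurableSet h1,
      setIntegral_indicator (measurableSet_Ioo.prod measurableSet_Ioo),
      inter_eq_self_of_subset_right hsub, Measure.volume_eq_prod,
      setIntegral_prod_mul (fun s : ℝ => s * w (s : ℂ)) (fun _ => (1 : ℝ))]
    congr 1
    simp [Real.volume_real_Ioo_of_le (show -δ ≤ δ by linarith)]
    ring
  rw [dA, Measure.restrict_smul, integral_smul_measure, key, ENNReal.toReal_inv,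
    ENNReal.toReal_ofReal Real.pi_pos.le, smul_eq_mul]
  ring

lemma dA_real_polarRect_ge {a b δ : ℝ} (ha : 1 / 2 ≤ a) (hab : a ≤ b) (hδ : 0 ≤ δ)
    (hδπ : δ ≤ Real.pi) :
    δ * (b - a) / Real.pi ≤ dA.real (polarRect a b δ) := by
  have h := setIntegral_polarRect (fun _ => 1) (fun _ => rfl) (a := a) (b := b)
    (by linarith) hδ hδπ
  simp only [setIntegral_const, smul_eq_mul, mul_one] at h
  rw [h]
  have h2 : volume.real (Ioo a b) • (1 / 2 : ℝ) ≤ ∫ s in Ioo a b, s :=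
    setIntegral_ge_of_const_le measurableSet_Ioo measure_Ioo_lt_top.ne
      (fun s hs => ha.trans hs.1.le)
      ((continuous_id.integrableOn_Icc).mono_set Ioo_subset_Icc_self)
  rw [Real.volume_real_Ioo_of_le hab, smul_eq_mul] at h2
  have h3 : 0 ≤ 2 * δ / Real.pi := by positivity
  calc δ * (b - a) / Real.pi = 2 * δ / Real.pi * ((b - a) * (1 / 2)) := by ring
    _ ≤ _ := by gcongr

/-- The integrand of `Pstd η` applied to an indicator function. -/
noncomputable def kerStd (η : ℝ) (z ζ : ℂ) : ℂ :=
  (((1 - ‖ζ‖ ^ 2) ^ η : ℝ) : ℂ) * (1 - z * conj ζ) ^ (((-(2 + η) : ℝ)) : ℂ)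

lemma measurable_kerStd (η : ℝ) : Measurable (Function.uncurry (kerStd η)) := by
  unfold kerStd Function.uncurry
  refine Measurable.mul (Complex.measurable_ofReal.comp ?_) ?_
  · exact Measurable.pow (by fun_prop) measurable_const
  · refine Measurable.pow ?_ measurable_const
    exact Continuous.measurable (by fun_prop)

lemma Pstd_indicator (η : ℝ) {S : Set ℂ} (hS : MeasurableSet S) (hSU : S ⊆ UD) (z : ℂ) :
    Pstd η (S.indicator 1) z = ((η + 1 : ℝ) : ℂ) * ∫ ζ in S, kerStd η z ζ ∂dA := by
  unfold Pstd
  congr 1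
  have : (fun ζ => S.indicator (1 : ℂ → ℂ) ζ * (((1 - ‖ζ‖ ^ 2) ^ η : ℝ) : ℂ) *
      (1 - z * conj ζ) ^ (((-(2 + η) : ℝ)) : ℂ)) = S.indicator (kerStd η z) := by
    funext ζ
    by_cases h : ζ ∈ S <;> simp [h, kerStd]
  rw [this, setIntegral_indicator hS, inter_eq_self_of_subset_right hSU]

lemma rpow_mem_Icc_of_mem_Icc (η : ℝ) {h x : ℝ} (hh : 0 < h) (h1 : h / 4 ≤ x) (h2 : x ≤ h) :
    x ^ η ∈ Icc ((1 / 4) ^ |η| * h ^ η) ((1 / 4) ^ (-|η|) * h ^ η) := by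
  have hu0 : 0 < x / h := div_pos (by linarith) hh
  have hu1 : x / h ≤ 1 := (div_le_one hh).2 h2
  have hu4 : 1 / 4 ≤ x / h := by rw [le_div_iff₀ hh]; linarith
  have hx : x ^ η = (x / h) ^ η * h ^ η := by
    rw [← Real.mul_rpow hu0.le hh.le, div_mul_cancel₀ _ hh.ne']
  rw [hx]
  constructor
  · gcongr
    exact (Real.rpow_le_rpow (by norm_num) hu4 (abs_nonneg η)).trans
      (Real.rpow_le_rpow_of_exponent_ge hu0 hu1 (le_abs_self η))
  · gcongr
    exact (Real.rpow_le_rpow_of_exponent_ge hu0 hu1 (neg_abs_le η)).trans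
      (Real.rpow_le_rpow_of_nonpos (by norm_num) hu4 (by simp))

lemma one_sub_sq_mem_Icc {h x : ℝ} (hh : 0 < h) (hh' : h ≤ 1 / 2) (h1 : 1 - h / 2 < x)
    (h2 : x < 1 - h / 4) : 1 - x ^ 2 ∈ Icc (h / 4) h :=
  ⟨by nlinarith, by nlinarith⟩

lemma norm_kerStd_le {η : ℝ} (hη : -1 < η) {h a b δ : ℝ} (hh : 0 < h) (hh' : h ≤ 1 / 2)
    (ha : a = 1 - h / 2) (hb : b = 1 - h / 4) {z ζ : ℂ} (hz : z ∈ UD) (hζ : ζ ∈ polarRect a b δ) :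
    ‖kerStd η z ζ‖ ≤ (1 / 4) ^ (-|η|) * h ^ η * (h / 4) ^ (-(2 + η)) := by
  have hz1 : ‖z‖ < 1 := by simpa [UD] using hz
  obtain ⟨⟨h1, h2⟩, -⟩ := hζ
  obtain ⟨hx1, hx2⟩ := one_sub_sq_mem_Icc hh hh' (ha ▸ h1) (hb ▸ h2)
  have hx := rpow_mem_Icc_of_mem_Icc η hh hx1 hx2
  have hd : h / 4 ≤ ‖1 - z * conj ζ‖ := by
    have := norm_sub_norm_le (1 : ℂ) (z * conj ζ)
    rw [norm_one, norm_mul, Complex.norm_conj] at this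
    nlinarith [norm_nonneg ζ]
  rw [kerStd, norm_mul, Complex.norm_cpow_real, Complex.norm_real,
    Real.norm_of_nonneg (Real.rpow_nonneg (by linarith) _)]
  exact mul_le_mul hx.2 (Real.rpow_le_rpow_of_nonpos (by positivity) hd (by linarith))
    (by positivity) (by positivity)

lemma abs_arg_le_abs_im_div_re {w : ℂ} (hw : 0 < w.re) : |w.arg| ≤ |w.im| / w.re := by
  have h := Complex.abs_arg_lt_pi_div_two_iff.2 (Or.inl hw)
  have htan := Complex.tan_arg w
  calc |w.arg| ≤ Real.tan |w.arg| := Real.le_tan (abs_nonneg _) h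
    _ = |Real.tan w.arg| := by
      rcases abs_cases w.arg with ⟨h1, h2⟩ | ⟨h1, h2⟩
      · rw [h1] at h ⊢
        exact (abs_of_nonneg (Real.tan_nonneg_of_nonneg_of_le_pi_div_two h2 h.le)).symm
      · rw [h1] at h ⊢
        rw [Real.tan_neg, abs_of_nonpos]
        exact Real.tan_nonpos_of_nonpos_of_neg_pi_div_two_le h2.le (by linarith)
    _ = |w.im| / w.re := by rw [htan, abs_div, abs_of_pos hw]

lemma re_cpow_neg_ge {w : ℂ} (hw : 0 < w.re) {s : ℝ} (hs : 0 < s) (him : s * |w.im| ≤ w.re) :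
    1 / 2 * ‖w‖ ^ (-s) ≤ (w ^ ((-s : ℝ) : ℂ)).re := by
  rw [Complex.cpow_ofReal_re, mul_comm]
  have h1 : |w.arg * -s| ≤ 1 := by
    rw [abs_mul, abs_neg, abs_of_pos hs]
    calc |w.arg| * s ≤ |w.im| / w.re * s := by gcongr; exact abs_arg_le_abs_im_div_re hw
      _ = s * |w.im| / w.re := by ring
      _ ≤ 1 := (div_le_one hw).2 him
  have h2 : 1 / 2 ≤ Real.cos (w.arg * -s) := by
    have := Real.one_sub_sq_div_two_le_cos (x := w.arg * -s)
    have h3 := (sq_le_one_iff_abs_le_one _).2 h1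
    linarith
  gcongr

lemma re_kerStd_ge {η : ℝ} (hη : -1 < η) {h a b δ : ℝ} (hh : 0 < h) (hh' : h ≤ 1 / 2)
    (ha : a = 1 - h / 2) (hb : b = 1 - h / 4) (hδ : δ = h / (8 * (2 + η)))
    {z ζ : ℂ} (hz : z ∈ polarRect (1 - h) 1 δ) (hζ : ζ ∈ polarRect a b δ) :
    (1 / 4) ^ |η| * (1 / 2 * 3 ^ (-(2 + η))) * (h ^ 2)⁻¹ ≤ (kerStd η z ζ).re := by
  obtain ⟨⟨hz1, hz2⟩, hz3, hz4⟩ := hz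
  obtain ⟨⟨h1, h2⟩, h3, h4⟩ := hζ
  have hη2 : 0 < 2 + η := by linarith
  obtain ⟨hx1, hx2⟩ := one_sub_sq_mem_Icc hh hh' (ha ▸ h1) (hb ▸ h2)
  have hx := (rpow_mem_Icc_of_mem_Icc η hh hx1 hx2).1
  set w := 1 - z * conj ζ with hw
  set θ := z.arg - ζ.arg with hθ
  set t := ‖z‖
  set ρ := ‖ζ‖
  have hre : w.re = 1 - t * ρ * Real.cos θ := by
    rw [hw, hθ, Real.cos_sub]
    simp only [Complex.sub_re, Complex.one_re, Complex.mul_re, Complex.conj_re, Complex.conj_im]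
    rw [← Complex.norm_mul_cos_arg z, ← Complex.norm_mul_cos_arg ζ,
      ← Complex.norm_mul_sin_arg z, ← Complex.norm_mul_sin_arg ζ]
    ring
  have him : w.im = -(t * ρ * Real.sin θ) := by
    rw [hw, hθ, Real.sin_sub]
    simp only [Complex.sub_im, Complex.one_im, Complex.mul_im, Complex.conj_re, Complex.conj_im]
    rw [← Complex.norm_mul_cos_arg z, ← Complex.norm_mul_cos_arg ζ,
      ← Complex.norm_mul_sin_arg z, ← Complex.norm_mul_sin_arg ζ]
    ring
  have hθδ : |θ| ≤ 2 * δ := by rw [abs_le]; constructor <;> linarith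
  have hδ8 : δ * (8 * (2 + η)) = h := by
    rw [hδ]; field_simp
  have hδ0 : 0 < δ := by rw [hδ]; positivity
  have hδh : 8 * δ ≤ h := by nlinarith [mul_pos hδ0 (by linarith : 0 < 1 + η)]
  have ht0 : 0 < t := by linarith
  have hρ0 : 0 < ρ := by linarith
  have htρ : t * ρ ≤ 1 - h / 4 := by
    have := mul_le_mul_of_nonneg_right hz2.le hρ0.le
    linarith
  have htρ0 : 0 < t * ρ := by positivity
  have htρ' : 1 - 2 * h ≤ t * ρ := by
    have := mul_le_mul hz1.le (ha ▸ h1.le : 1 - h / 2 ≤ ρ) (by linarith) ht0.le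
    linarith [sq_nonneg h]
  have hre1 : h / 4 ≤ w.re := by
    have := mul_le_mul_of_nonneg_left (Real.cos_le_one θ) htρ0.le
    linarith
  have him1 : |w.im| ≤ 2 * δ := by
    rw [him, abs_neg, abs_mul, abs_of_pos htρ0]
    have := Real.abs_sin_le_abs (x := θ)
    have h5 := mul_le_mul_of_nonneg_right (by linarith : t * ρ ≤ 1) (abs_nonneg (Real.sin θ))
    linarith
  have hre2 : w.re ≤ 2 * h + h / 4 := by
    have hc := Real.one_sub_sq_div_two_le_cos (x := θ)
    have hsq : θ ^ 2 ≤ (2 * δ) ^ 2 :=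
      sq_le_sq' (by linarith [neg_abs_le θ]) (by linarith [le_abs_self θ])
    have hδδ : δ * δ ≤ h / 8 * 1 := mul_le_mul (by linarith) (by linarith) hδ0.le (by linarith)
    have hsq' : θ ^ 2 / 2 ≤ h / 4 := by linarith
    have hcos : t * ρ * (1 - h / 4) ≤ t * ρ * Real.cos θ :=
      mul_le_mul_of_nonneg_left (by linarith) htρ0.le
    have hle1 : t * ρ * (h / 4) ≤ 1 * (h / 4) :=
      mul_le_mul_of_nonneg_right (by linarith) (by linarith)
    rw [hre]
    linarith
  have hwn : ‖w‖ ≤ 3 * h := by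
    have := Complex.norm_le_abs_re_add_abs_im w
    rw [abs_of_pos (by linarith : 0 < w.re)] at this
    linarith
  have hwpos : 0 < ‖w‖ := by
    have := Complex.re_le_norm w
    linarith
  have him2 : (2 + η) * |w.im| ≤ w.re := by
    have := mul_le_mul_of_nonneg_left him1 hη2.le
    linarith
  have hker := re_cpow_neg_ge (w := w) (by linarith) hη2 him2
  have hker2 : (3 * h) ^ (-(2 + η)) ≤ ‖w‖ ^ (-(2 + η)) :=
    Real.rpow_le_rpow_of_nonpos hwpos hwn (by linarith)
  rw [kerStd, Complex.re_ofReal_mul]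
  have hpow : h ^ η * h ^ (-(2 + η)) = (h ^ 2)⁻¹ := by
    rw [← Real.rpow_add hh, ← Real.rpow_natCast h 2, ← Real.rpow_neg hh.le]
    congr 1; push_cast; ring
  calc (1 / 4) ^ |η| * (1 / 2 * 3 ^ (-(2 + η))) * (h ^ 2)⁻¹
      = ((1 / 4) ^ |η| * h ^ η) * (1 / 2 * (3 * h) ^ (-(2 + η))) := by
        rw [← hpow, Real.mul_rpow (by norm_num) hh.le]; ring
    _ ≤ _ := mul_le_mul hx ((mul_le_mul_of_nonneg_left hker2 (by norm_num)).trans hker)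
        (by positivity) (Real.rpow_nonneg (by linarith) _)

lemma norm_Pstd_indicator_ge {η : ℝ} (hη : -1 < η) {h a b δ : ℝ} (hh : 0 < h) (hh' : h ≤ 1 / 2)
    (ha : a = 1 - h / 2) (hb : b = 1 - h / 4) (hδ : δ = h / (8 * (2 + η)))
    {z : ℂ} (hz : z ∈ polarRect (1 - h) 1 δ) :
    (η + 1) * ((1 / 4) ^ |η| * (1 / 2 * 3 ^ (-(2 + η))) * (1 / (32 * (2 + η) * Real.pi))) ≤
      ‖Pstd η ((polarRect a b δ).indicator 1) z‖ := by
  have hη2 : 0 < 2 + η := by linarith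
  have hS := measurableSet_polarRect a b δ
  have hb1 : b ≤ 1 := by linarith
  have hfin : dA (polarRect a b δ) < ⊤ := dA_polarRect_lt_top hb1
  have hzU : z ∈ UD := polarRect_subset_UD le_rfl hz
  have hδ0 : 0 < δ := by rw [hδ]; positivity
  have hδ1 : δ ≤ 1 := by
    rw [hδ, div_le_one (by positivity)]; linarith
  have hint : IntegrableOn (kerStd η z) (polarRect a b δ) dA := by
    refine Measure.integrableOn_of_bounded hfin.ne
      ((measurable_kerStd η).comp measurable_prodMk_left).aestronglyMeasurable
      ((ae_restrict_iff' hS).2 (Filter.Eventually.of_forall fun ζ hζ =>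
        norm_kerStd_le hη hh hh' ha hb hzU hζ))
  rw [Pstd_indicator η hS (polarRect_subset_UD hb1), norm_mul, Complex.norm_real,
    Real.norm_of_nonneg (by linarith : 0 ≤ η + 1)]
  refine mul_le_mul_of_nonneg_left ?_ (by linarith)
  refine le_trans ?_ (Complex.re_le_norm _)
  have hre : (∫ ζ in polarRect a b δ, kerStd η z ζ ∂dA).re =
      ∫ ζ in polarRect a b δ, (kerStd η z ζ).re ∂dA := (integral_re hint).symm
  rw [hre]
  refine le_trans ?_ (setIntegral_ge_of_const_le hS hfin.ne
    (fun ζ hζ => re_kerStd_ge hη hh hh' ha hb hδ hz hζ) hint.re)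
  have hA := dA_real_polarRect_ge (a := a) (b := b) (δ := δ) (by linarith) (by linarith) hδ0.le
    (hδ1.trans (by linarith [Real.pi_gt_three]))
  have hA' : δ * (b - a) / Real.pi = h ^ 2 * (1 / (32 * (2 + η) * Real.pi)) := by
    rw [hδ, ha, hb]; field_simp; ring
  rw [hA'] at hA
  rw [smul_eq_mul, mul_comm (dA.real _)]
  calc _ = (1 / 4) ^ |η| * (1 / 2 * 3 ^ (-(2 + η))) * (h ^ 2)⁻¹ *
        (h ^ 2 * (1 / (32 * (2 + η) * Real.pi))) := by
          field_simp
    _ ≤ _ := by gcongr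

lemma integrableOn_norm_Pstd_indicator_rpow_mul {ν : ℂ → ℝ} (hν : IntegrableOn ν UD dA)
    {q : ℝ} (hq : 0 < q) {η : ℝ} (hη : -1 < η) {h a b : ℝ} (δ : ℝ) (hh : 0 < h) (hh' : h ≤ 1 / 2)
    (ha : a = 1 - h / 2) (hb : b = 1 - h / 4) :
    IntegrableOn (fun z => ‖Pstd η ((polarRect a b δ).indicator 1) z‖ ^ q * ν z) UD dA := by
  have hS := measurableSet_polarRect a b δ
  have hb1 : b ≤ 1 := by linarith
  have hfin : dA (polarRect a b δ) < ⊤ := dA_polarRect_lt_top hb1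
  have : IsFiniteMeasure (dA.restrict (polarRect a b δ)) := ⟨by simpa using hfin⟩
  have hmeas : StronglyMeasurable (fun z => ∫ ζ in polarRect a b δ, kerStd η z ζ ∂dA) :=
    StronglyMeasurable.integral_prod_right (measurable_kerStd η).stronglyMeasurable
  have hPm : Measurable (Pstd η ((polarRect a b δ).indicator 1)) := by
    have : Pstd η ((polarRect a b δ).indicator 1) =
        fun z => ((η + 1 : ℝ) : ℂ) * ∫ ζ in polarRect a b δ, kerStd η z ζ ∂dA :=
      funext fun z => Pstd_indicator η hS (polarRect_subset_UD hb1) z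
    rw [this]
    exact hmeas.measurable.const_mul _
  set M := (1 / 4) ^ (-|η|) * h ^ η * (h / 4) ^ (-(2 + η)) with hM
  refine Integrable.bdd_mul (c := (‖((η + 1 : ℝ) : ℂ)‖ * (M * dA.real (polarRect a b δ))) ^ q) hν
    (hPm.norm.pow_const q).aestronglyMeasurable ?_
  refine (ae_restrict_iff' (Metric.isOpen_ball.measurableSet : MeasurableSet UD)).2
    (Filter.Eventually.of_forall fun z hz => ?_)
  rw [Real.norm_of_nonneg (by positivity)]
  gcongr
  rw [Pstd_indicator η hS (polarRect_subset_UD hb1), norm_mul]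
  gcongr
  exact norm_setIntegral_le_of_norm_le_const hfin
    fun ζ hζ => norm_kerStd_le hη hh hh' ha hb hz hζ

lemma intervalIntegrable_of_WhatPos {ν : ℂ → ℝ} (hνp : WhatPos ν) :
    IntervalIntegrable (fun s : ℝ => ν (s : ℂ)) volume 0 1 := by
  by_contra hcon
  have := hνp 0 le_rfl one_pos
  rw [what, intervalIntegral.integral_undef hcon] at this
  exact this.false

lemma intervalIntegrable_of_WhatPos_of_mem {ν : ℂ → ℝ} (hνp : WhatPos ν) {a b : ℝ}
    (ha : a ∈ Icc (0 : ℝ) 1) (hb : b ∈ Icc (0 : ℝ) 1) :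
    IntervalIntegrable (fun s : ℝ => ν (s : ℂ)) volume a b :=
  (intervalIntegrable_of_WhatPos hνp).mono_set
    (uIcc_subset_uIcc (by rwa [uIcc_of_le zero_le_one]) (by rwa [uIcc_of_le zero_le_one]))

lemma what_sub_what {ν : ℂ → ℝ} (hνp : WhatPos ν) {a b : ℝ}
    (ha : a ∈ Icc (0 : ℝ) 1) (hb : b ∈ Icc (0 : ℝ) 1) :
    what ν a - what ν b = ∫ s in a..b, ν (s : ℂ) := by
  have h1 : (1 : ℝ) ∈ Icc (0 : ℝ) 1 := by simp
  rw [what, what, sub_eq_iff_eq_add, intervalIntegral.integral_add_adjacent_intervals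
    (intervalIntegrable_of_WhatPos_of_mem hνp ha hb)
    (intervalIntegrable_of_WhatPos_of_mem hνp hb h1)]

lemma what_anti {ν : ℂ → ℝ} (hν : ∀ z, 0 ≤ ν z) (hνp : WhatPos ν) {a b : ℝ}
    (ha : 0 ≤ a) (hab : a ≤ b) (hb : b ≤ 1) : what ν b ≤ what ν a := by
  have h := what_sub_what hνp (a := a) (b := b) ⟨ha, hab.trans hb⟩ ⟨ha.trans hab, hb⟩
  have : 0 ≤ ∫ s in a..b, ν (s : ℂ) :=
    intervalIntegral.integral_nonneg hab fun s _ => hν _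
  linarith

/-- Testing the Bergman projection on the indicator of a polar rectangle. -/
lemma exists_what_le_what_sub_what {q : ℝ} (hq : 0 < q) {ν : ℂ → ℝ} (hν : RadialWeight ν)
    (hνp : WhatPos ν) (hνq : Bq q ν) :
    ∃ C > (1 : ℝ), ∀ h : ℝ, 0 < h → h ≤ 1 / 2 →
      what ν (1 - h) ≤ C * (what ν (1 - h / 2) - what ν (1 - h / 4)) := by
  obtain ⟨η, hη, C, hC, hP⟩ := hνq
  obtain ⟨hν0, hνr, hνi⟩ := hν
  have hη2 : 0 < 2 + η := by linarith
  set c := (η + 1) * ((1 / 4) ^ |η| * (1 / 2 * 3 ^ (-(2 + η))) *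
    (1 / (32 * (2 + η) * Real.pi))) with hc
  have hc0 : 0 < c := by
    have : 0 < η + 1 := by linarith
    positivity
  have hCc : 0 < 2 * C ^ q / c ^ q := by positivity
  refine ⟨2 * C ^ q / c ^ q + 2, by linarith, ?_⟩
  intro h hh hh'
  obtain ⟨a, ha⟩ : ∃ a, a = 1 - h / 2 := ⟨_, rfl⟩
  obtain ⟨b, hb⟩ : ∃ b, b = 1 - h / 4 := ⟨_, rfl⟩
  obtain ⟨δ, hδ⟩ : ∃ δ, δ = h / (8 * (2 + η)) := ⟨_, rfl⟩
  have hb1 : b ≤ 1 := by linarith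
  have hδ0 : 0 < δ := by rw [hδ]; positivity
  have hδπ : δ ≤ Real.pi := by
    have : δ ≤ 1 := by rw [hδ, div_le_one (by positivity)]; linarith
    linarith [Real.pi_gt_three]
  have hS := measurableSet_polarRect a b δ
  set f : ℂ → ℂ := (polarRect a b δ).indicator 1 with hf
  have hfq : (fun z => ‖f z‖ ^ q * ν z) = (polarRect a b δ).indicator ν := by
    funext z
    by_cases hz : z ∈ polarRect a b δ <;> simp [hf, hz, Real.zero_rpow hq.ne']
  have hmem : MemLw q ν f := by
    refine ⟨(measurable_one.indicator hS).aestronglyMeasurable, ?_⟩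
    rw [hfq]
    exact Integrable.indicator hνi hS
  have hle := hP f hmem
  have hfint : ∫ z in UD, ‖f z‖ ^ q * ν z ∂dA = ∫ z in polarRect a b δ, ν z ∂dA := by
    rw [hfq, setIntegral_indicator hS, inter_eq_self_of_subset_right (polarRect_subset_UD hb1)]
  have hPint := integrableOn_norm_Pstd_indicator_rpow_mul hνi hq hη δ hh hh' ha hb
  have hA0 : 0 ≤ ∫ z in UD, ‖Pstd η f z‖ ^ q * ν z ∂dA :=
    integral_nonneg fun z => mul_nonneg (by positivity) (hν0 z)
  have hB0 : 0 ≤ ∫ z in polarRect a b δ, ν z ∂dA := integral_nonneg fun z => hν0 z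
  have hpow : ∫ z in UD, ‖Pstd η f z‖ ^ q * ν z ∂dA ≤
      C ^ q * ∫ z in polarRect a b δ, ν z ∂dA := by
    rw [wnorm, wnorm, hfint] at hle
    have := Real.rpow_le_rpow (Real.rpow_nonneg hA0 _) hle hq.le
    rwa [Real.mul_rpow hC.le (Real.rpow_nonneg hB0 _), ← Real.rpow_mul hA0, ← Real.rpow_mul hB0,
      one_div_mul_cancel hq.ne', Real.rpow_one, Real.rpow_one] at this
  have hlow : c ^ q * ∫ z in polarRect (1 - h) 1 δ, ν z ∂dA ≤
      ∫ z in UD, ‖Pstd η f z‖ ^ q * ν z ∂dA := by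
    rw [← integral_const_mul]
    refine le_trans ?_ (setIntegral_mono_set hPint
      (Filter.Eventually.of_forall fun z => mul_nonneg (by positivity) (hν0 z))
      (polarRect_subset_UD (le_refl (1 : ℝ)) : polarRect (1 - h) 1 δ ⊆ UD).eventuallyLE)
    refine setIntegral_mono_on ((hνi.mono_set (polarRect_subset_UD le_rfl)).const_mul _)
      (hPint.mono_set (polarRect_subset_UD le_rfl)) (measurableSet_polarRect _ _ _)
      fun z hz => ?_
    have := norm_Pstd_indicator_ge hη hh hh' ha hb hδ hz
    have := hν0 z
    gcongr
  have hmain := hlow.trans hpow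
  rw [setIntegral_polarRect ν hνr (by linarith) hδ0.le hδπ,
    setIntegral_polarRect ν hνr (by linarith) hδ0.le hδπ] at hmain
  have hmain' : c ^ q * ∫ s in Ioo (1 - h) 1, s * ν (s : ℂ) ≤
      C ^ q * ∫ s in Ioo a b, s * ν (s : ℂ) := by
    have hk : 0 < 2 * δ / Real.pi := by positivity
    refine le_of_mul_le_mul_left ?_ hk
    linarith
  have hint : ∀ {x y : ℝ}, x ∈ Icc (0 : ℝ) 1 → y ∈ Icc (0 : ℝ) 1 → x ≤ y →
      IntegrableOn (fun s : ℝ => ν (s : ℂ)) (Ioo x y) := fun hx hy hxy =>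
    ((intervalIntegrable_iff_integrableOn_Ioc_of_le hxy).1
      (intervalIntegrable_of_WhatPos_of_mem hνp hx hy)).mono_set Ioo_subset_Ioc_self
  have hint' : ∀ {x y : ℝ}, x ∈ Icc (0 : ℝ) 1 → y ∈ Icc (0 : ℝ) 1 → x ≤ y →
      IntegrableOn (fun s : ℝ => s * ν (s : ℂ)) (Ioo x y) := fun hx hy hxy => by
    refine Integrable.bdd_mul (c := 1) (hint hx hy hxy) measurable_id.aestronglyMeasurable ?_
    refine (ae_restrict_iff' measurableSet_Ioo).2 (Filter.Eventually.of_forall fun s hs => ?_)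
    rw [Real.norm_of_nonneg (hx.1.trans hs.1.le)]
    exact hs.2.le.trans hy.2
  have h0 : 1 - h ∈ Icc (0 : ℝ) 1 := ⟨by linarith, by linarith⟩
  have h1 : (1 : ℝ) ∈ Icc (0 : ℝ) 1 := by simp
  have haI : a ∈ Icc (0 : ℝ) 1 := ⟨by linarith, by linarith⟩
  have hbI : b ∈ Icc (0 : ℝ) 1 := ⟨by linarith, by linarith⟩
  have hab : a ≤ b := by linarith
  have hL : 1 / 2 * what ν (1 - h) ≤ ∫ s in Ioo (1 - h) 1, s * ν (s : ℂ) := by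
    rw [what, intervalIntegral.integral_of_le h0.2, integral_Ioc_eq_integral_Ioo,
      ← integral_const_mul]
    refine setIntegral_mono_on ((hint h0 h1 h0.2).const_mul _) (hint' h0 h1 h0.2)
      measurableSet_Ioo fun s hs => ?_
    exact mul_le_mul_of_nonneg_right (by linarith [hs.1]) (hν0 _)
  have hU : ∫ s in Ioo a b, s * ν (s : ℂ) ≤ what ν a - what ν b := by
    rw [what_sub_what hνp haI hbI, intervalIntegral.integral_of_le hab,
      integral_Ioc_eq_integral_Ioo]
    refine setIntegral_mono_on (hint' haI hbI hab) (hint haI hbI hab)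
      measurableSet_Ioo fun s hs => ?_
    exact mul_le_of_le_one_left (hν0 _) (by linarith [hs.2])
  have hd : 0 ≤ what ν a - what ν b := by
    linarith [what_anti hν0 hνp haI.1 hab hb1]
  rw [← ha, ← hb]
  have hcq : 0 < c ^ q := by positivity
  have hfin : what ν (1 - h) ≤ 2 * C ^ q / c ^ q * (what ν a - what ν b) := by
    rw [div_mul_eq_mul_div, le_div_iff₀ hcq]
    have e1 := mul_le_mul_of_nonneg_left hL hcq.le
    have e2 := mul_le_mul_of_nonneg_left hU (by positivity : 0 ≤ C ^ q)
    linarith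
  linarith

/-- Proposition 2.6, first part: a radial weight in `B_q` belongs to `D`. -/
theorem Bq_subset_Dclass (q : ℝ) (hq : 1 < q)
    (ν : ℂ → ℝ) (hν : RadialWeight ν) (hνp : WhatPos ν) (hνq : Bq q ν) :
    Dclass ν := by
  obtain ⟨C, hC, hmain⟩ := exists_what_le_what_sub_what (by linarith) hν hνp hνq
  have hν0 := hν.1
  have hC0 : 0 < C := by linarith
  constructor
  · have h34 : 0 < what ν (3 / 4) := hνp _ (by norm_num) (by norm_num)
    have h0 : 0 < what ν 0 := hνp 0 le_rfl one_pos
    refine ⟨C + what ν 0 / what ν (3 / 4), by linarith [div_pos h0 h34], fun r hr0 hr1 => ?_⟩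
    have hpos : 0 < what ν ((1 + r) / 2) := hνp _ (by linarith) (by linarith)
    rcases le_total (1 / 2) r with hr | hr
    · have h := hmain (1 - r) (by linarith) (by linarith)
      have hb : 0 < what ν (1 - (1 - r) / 4) := hνp _ (by linarith) (by linarith)
      rw [show 1 - (1 - r) = r by ring, show 1 - (1 - r) / 2 = (1 + r) / 2 by ring] at h
      have : 0 ≤ what ν 0 / what ν (3 / 4) * what ν ((1 + r) / 2) := by positivity
      nlinarith
    · have e1 : what ν r ≤ what ν 0 := what_anti hν0 hνp le_rfl hr0 hr1.le
      have e2 : what ν (3 / 4) ≤ what ν ((1 + r) / 2) :=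
        what_anti hν0 hνp (by linarith) (by linarith) (by linarith)
      have e3 : what ν 0 ≤ what ν 0 / what ν (3 / 4) * what ν ((1 + r) / 2) := by
        rw [div_mul_eq_mul_div, le_div_iff₀ h34]
        exact mul_le_mul_of_nonneg_left e2 h0.le
      have : 0 < C * what ν ((1 + r) / 2) := by positivity
      linarith
  · refine ⟨8, by norm_num, C / (C - 1), ?_, fun r hr0 hr1 => ?_⟩
    · rw [gt_iff_lt, lt_div_iff₀ (by linarith)]; linarith
    · obtain ⟨h, hh0, hh2, hhr, hr2⟩ :
          ∃ h, 0 < h ∧ h ≤ 1 / 2 ∧ h ≤ 1 - r ∧ 1 - r ≤ 2 * h := by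
        rcases le_total (1 / 2) r with hr | hr
        · exact ⟨1 - r, by linarith, by linarith, le_rfl, by linarith⟩
        · exact ⟨1 / 2, by norm_num, le_rfl, by linarith, by linarith⟩
      have e0 := hmain h hh0 hh2
      have e1 : what ν (1 - (1 - r) / 8) ≤ what ν (1 - h / 4) :=
        what_anti hν0 hνp (by linarith) (by linarith) (by linarith)
      have e2 : what ν (1 - h / 2) ≤ what ν (1 - h) :=
        what_anti hν0 hνp (by linarith) (by linarith) (by linarith)
      have e3 : what ν (1 - h) ≤ what ν r :=
        what_anti hν0 hνp hr0 (by linarith) (by linarith)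
      rw [div_mul_eq_mul_div, div_le_iff₀ (by linarith)]
      have f1 := mul_le_mul_of_nonneg_left e1 hC0.le
      have f2 := mul_le_mul_of_nonneg_left e2 hC0.le
      have f3 := mul_le_mul_of_nonneg_left e3 (by linarith : 0 ≤ C - 1)
      linarith
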